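/- arXiv:2510.01964 — 2 statements merged into one kernel-verified Lean document; each statement's English description precedes it below -/
import Mathlib

section
/- Let c₀ ∈ ℝ and c = (c₁,c₂,c₃) ∈ ℝ³, and let M(c₀,c) be the symmetric 10×10 real matrix M(c₀,c) = c₀·I₁₀ + Σ_{ℓ=1}^{3} c_ℓ · [[0, A_ℓ],[A_ℓᵀ, 0]] (2×2 block form with 5×5 blocks). Then the set of eigenvalues of M(c₀,c) equals {c₀, c₀+|c|, c₀−|c|, c₀+|c|/2, c₀−|c|/2}, where |c| = √(c₁²+c₂²+c₃²); in particular M(c₀,c) is positive definite if and only if c₀ > |c|. -/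
open Matrix

/-- The three `5 × 5` matrices `A_{2,1}, A_{2,2}, A_{2,3}` of Lemma 4.9 of the paper. -/
noncomputable def A2mats : Fin 3 → Matrix (Fin 5) (Fin 5) ℝ :=
  ![!![0, 0, -(1/2), 0, 0;
      0, 0, 0, -(1/2), Real.sqrt 3 / 2;
      1/2, 0, 0, 0, 0;
      0, 1/2, 0, 0, 0;
      0, -(Real.sqrt 3 / 2), 0, 0, 0],
    !![0, 1/2, 0, 0, 0;
      -(1/2), 0, 0, 0, 0;
      0, 0, 0, -(1/2), -(Real.sqrt 3 / 2);
      0, 0, 1/2, 0, 0;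
      0, 0, Real.sqrt 3 / 2, 0, 0],
    !![0, 0, 0, 1, 0;
      0, 0, 1/2, 0, 0;
      0, -(1/2), 0, 0, 0;
      -1, 0, 0, 0, 0;
      0, 0, 0, 0, 0]]

/-- The symmetric `10 × 10` matrix
`M(c₀,c) = c₀·I + Σ_ℓ c_ℓ · [[0, A_ℓ],[A_ℓᵀ, 0]]` (with `5 × 5` blocks). -/
noncomputable def M10 (c₀ : ℝ) (c : Fin 3 → ℝ) :
    Matrix (Fin 5 ⊕ Fin 5) (Fin 5 ⊕ Fin 5) ℝ :=
  c₀ • (1 : Matrix (Fin 5 ⊕ Fin 5) (Fin 5 ⊕ Fin 5) ℝ) +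
    ∑ l : Fin 3, c l • Matrix.fromBlocks 0 (A2mats l) (A2mats l)ᵀ 0

/-- Generic form of the linear combination of the three matrices. -/
def gA {R : Type*} [CommRing R] (x y z a b h : R) : Matrix (Fin 5) (Fin 5) R :=
  !![a, h * y, -(h * x), z, 0;
     -(h * y), a, h * z, -(h * x), b * x;
     h * x, -(h * z), a, -(h * y), -(b * y);
     -z, h * x, h * y, a, 0;
     0, -(b * x), b * y, 0, a]

set_option maxHeartbeats 2000000 in
lemma gA_det (x y z t b h : ℂ) (hh : h = 1 / 2) (hb : b ^ 2 = 3 / 4) :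
    (gA x y z t b h).det =
      t * (t ^ 2 + (x ^ 2 + y ^ 2 + z ^ 2)) * (t ^ 2 + (x ^ 2 + y ^ 2 + z ^ 2) / 4) := by
  subst hh
  simp [gA, Matrix.det_succ_row_zero, Fin.sum_univ_succ, Fin.succAbove]
  ring_nf
  have h4 : b ^ 4 = 9 / 16 := by
    have : b ^ 4 = (b ^ 2) ^ 2 := by ring
    rw [this, hb]; norm_num
  simp only [hb, h4]
  ring

lemma M10_eq (c₀ : ℝ) (c : Fin 3 → ℝ) :
    M10 c₀ c = Matrix.fromBlocks (c₀ • 1) (gA (c 0) (c 1) (c 2) 0 (√3 / 2) (1 / 2))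
      (-(gA (c 0) (c 1) (c 2) 0 (√3 / 2) (1 / 2))) (c₀ • 1) := by
  ext i j
  rcases i with i | i <;> rcases j with j | j
  · simp [M10, Fin.sum_univ_succ, Matrix.one_apply]
  · fin_cases i <;> fin_cases j <;> simp [M10, Fin.sum_univ_succ, A2mats, gA] <;> ring
  · fin_cases i <;> fin_cases j <;> simp [M10, Fin.sum_univ_succ, A2mats, gA] <;> ring
  · simp [M10, Fin.sum_univ_succ, Matrix.one_apply]

lemma det_block (t : ℂ) (A : Matrix (Fin 5) (Fin 5) ℂ) :
    (Matrix.fromBlocks (t • 1) A (-A) (t • 1)).det =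
      (t • 1 + Complex.I • A).det * (t • 1 - Complex.I • A).det := by
  have h : Matrix.fromBlocks 1 0 (-(Complex.I • (1 : Matrix (Fin 5) (Fin 5) ℂ))) 1 *
      Matrix.fromBlocks (t • 1) A (-A) (t • 1) *
      Matrix.fromBlocks 1 0 (Complex.I • (1 : Matrix (Fin 5) (Fin 5) ℂ)) 1 =
      Matrix.fromBlocks (t • 1 + Complex.I • A) A 0 (t • 1 - Complex.I • A) := by
    simp only [Matrix.fromBlocks_multiply]
    congr 1
    · simp
    · simp
    · simp [smul_smul, mul_comm, add_mul, mul_add, smul_add]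
    · simp [sub_eq_add_neg, add_comm]
  have h2 := congrArg Matrix.det h
  rw [Matrix.det_mul, Matrix.det_mul, Matrix.det_fromBlocks_zero₁₂,
    Matrix.det_fromBlocks_zero₁₂, Matrix.det_fromBlocks_zero₂₁] at h2
  simpa using h2

lemma M10_det (t : ℝ) (c : Fin 3 → ℝ) :
    (M10 t c).det = t ^ 2 * (t ^ 2 - (c 0 ^ 2 + c 1 ^ 2 + c 2 ^ 2)) ^ 2 *
      (t ^ 2 - (c 0 ^ 2 + c 1 ^ 2 + c 2 ^ 2) / 4) ^ 2 := by
  have hb : ((√3 / 2 : ℝ) : ℂ) ^ 2 = 3 / 4 := by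
    rw [← Complex.ofReal_pow, div_pow, Real.sq_sqrt (by norm_num)]
    norm_num
  have hI := Complex.I_sq
  apply Complex.ofReal_injective
  have e : (((M10 t c).det : ℝ) : ℂ) = ((M10 t c).map Complex.ofRealHom).det := by
    exact RingHom.map_det Complex.ofRealHom _
  have e2 : (M10 t c).map Complex.ofRealHom =
      Matrix.fromBlocks ((t : ℂ) • 1) (gA (c 0 : ℂ) (c 1) (c 2) 0 ((√3 / 2 : ℝ) : ℂ) (1 / 2))
      (-(gA (c 0 : ℂ) (c 1) (c 2) 0 ((√3 / 2 : ℝ) : ℂ) (1 / 2))) ((t : ℂ) • 1) := by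
    have e3 : (gA (c 0) (c 1) (c 2) 0 (√3 / 2) (1 / 2)).map Complex.ofRealHom =
        gA (c 0 : ℂ) (c 1) (c 2) 0 ((√3 / 2 : ℝ) : ℂ) (1 / 2) := by
      ext i j
      fin_cases i <;> fin_cases j <;> simp [gA]
    have e4 : (t • (1 : Matrix (Fin 5) (Fin 5) ℝ)).map Complex.ofRealHom = (t : ℂ) • 1 := by
      ext i j
      by_cases hij : i = j <;> simp [Matrix.one_apply, hij]
    rw [M10_eq, Matrix.fromBlocks_map, e4, ← e3]
    congr 1
    ext i j
    simp
  have e5 : ∀ (s : ℂ) , (t : ℂ) • (1 : Matrix (Fin 5) (Fin 5) ℂ) +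
      s • gA (c 0 : ℂ) (c 1) (c 2) 0 ((√3 / 2 : ℝ) : ℂ) (1 / 2) =
      gA (s * c 0 : ℂ) (s * c 1) (s * c 2) t ((√3 / 2 : ℝ) : ℂ) (1 / 2) := by
    intro s
    ext i j
    fin_cases i <;> fin_cases j <;> simp [gA] <;> ring
  rw [e, e2, det_block, sub_eq_add_neg, ← neg_smul, e5, e5, gA_det _ _ _ _ _ _ rfl hb,
    gA_det _ _ _ _ _ _ rfl hb]
  push_cast
  simp only [mul_pow, neg_sq, hI]
  ring

lemma M10_sub (μ c₀ : ℝ) (c : Fin 3 → ℝ) :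
    algebraMap ℝ _ μ - M10 c₀ c = M10 (μ - c₀) (-c) := by
  simp only [M10, Algebra.algebraMap_eq_smul_one, Pi.neg_apply, neg_smul,
    Finset.sum_neg_distrib, sub_smul]
  abel

lemma M10_herm (c₀ : ℝ) (c : Fin 3 → ℝ) : (M10 c₀ c).IsHermitian := by
  unfold M10 Matrix.IsHermitian
  simp [Matrix.conjTranspose_eq_transpose_of_trivial, Fin.sum_univ_succ,
    Matrix.transpose_add, Matrix.transpose_smul, Matrix.fromBlocks_transpose]

/-- Remark 4.12 (case k = 2) of the paper: the set of eigenvalues of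
`M(c₀,c)` is `{c₀, c₀ ± |c|, c₀ ± |c|/2}`; in particular `M(c₀,c)` is positive definite
iff `c₀ > |c|`. -/
theorem stmt1 (c₀ : ℝ) (c : Fin 3 → ℝ) :
    spectrum ℝ (M10 c₀ c) =
      {c₀, c₀ + Real.sqrt ((c 0) ^ 2 + (c 1) ^ 2 + (c 2) ^ 2),
           c₀ - Real.sqrt ((c 0) ^ 2 + (c 1) ^ 2 + (c 2) ^ 2),
           c₀ + Real.sqrt ((c 0) ^ 2 + (c 1) ^ 2 + (c 2) ^ 2) / 2,
           c₀ - Real.sqrt ((c 0) ^ 2 + (c 1) ^ 2 + (c 2) ^ 2) / 2} ∧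
    ((M10 c₀ c).PosDef ↔ Real.sqrt ((c 0) ^ 2 + (c 1) ^ 2 + (c 2) ^ 2) < c₀) := by
  have hspec : spectrum ℝ (M10 c₀ c) =
      {c₀, c₀ + Real.sqrt ((c 0) ^ 2 + (c 1) ^ 2 + (c 2) ^ 2),
           c₀ - Real.sqrt ((c 0) ^ 2 + (c 1) ^ 2 + (c 2) ^ 2),
           c₀ + Real.sqrt ((c 0) ^ 2 + (c 1) ^ 2 + (c 2) ^ 2) / 2,
           c₀ - Real.sqrt ((c 0) ^ 2 + (c 1) ^ 2 + (c 2) ^ 2) / 2} := by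
    ext μ
    rw [spectrum.mem_iff, M10_sub, Matrix.isUnit_iff_isUnit_det, isUnit_iff_ne_zero, not_not,
      M10_det]
    have hr : Real.sqrt ((c 0) ^ 2 + (c 1) ^ 2 + (c 2) ^ 2) ^ 2 =
        (c 0) ^ 2 + (c 1) ^ 2 + (c 2) ^ 2 := Real.sq_sqrt (by positivity)
    simp only [Pi.neg_apply, neg_sq]
    generalize hrr : Real.sqrt ((c 0) ^ 2 + (c 1) ^ 2 + (c 2) ^ 2) = r at *
    rw [← hr]
    have hf : (μ - c₀) ^ 2 * ((μ - c₀) ^ 2 - r ^ 2) ^ 2 * ((μ - c₀) ^ 2 - r ^ 2 / 4) ^ 2 =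
        ((μ - c₀) * ((μ - (c₀ + r)) * ((μ - (c₀ - r)) *
          ((μ - (c₀ + r / 2)) * (μ - (c₀ - r / 2)))))) ^ 2 := by ring
    rw [hf, pow_eq_zero_iff two_ne_zero]
    simp only [mul_eq_zero, sub_eq_zero, Set.mem_insert_iff, Set.mem_singleton_iff]
  refine ⟨hspec, ?_⟩
  have hH := M10_herm c₀ c
  rw [hH.posDef_iff_eigenvalues_pos]
  have hrange := hH.spectrum_real_eq_range_eigenvalues
  rw [hspec] at hrange
  have hr : 0 ≤ Real.sqrt ((c 0) ^ 2 + (c 1) ^ 2 + (c 2) ^ 2) := Real.sqrt_nonneg _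
  generalize Real.sqrt ((c 0) ^ 2 + (c 1) ^ 2 + (c 2) ^ 2) = r at *
  constructor
  · intro h
    have hm : c₀ - r ∈ Set.range hH.eigenvalues := by
      rw [← hrange]; simp
    obtain ⟨i, hi⟩ := hm
    have := h i
    linarith
  · intro h i
    have hm : hH.eigenvalues i ∈ Set.range hH.eigenvalues := ⟨i, rfl⟩
    rw [← hrange] at hm
    simp only [Set.mem_insert_iff, Set.mem_singleton_iff] at hm
    rcases hm with hm | hm | hm | hm | hm <;> rw [hm] <;> linarith
end

section
/- For every k ∈ ℕ there exists a constant C(k) > 0 such that for all a ≥ 0, all 0 < s ≤ s* ≤ 1, and every smooth function f : Δ̲_{≤s*} → ℝ, one has ‖f‖_{H_b^k(A(s/3, s))} ≤ C(k) · (s/s*)^{a+k} · ‖f‖_{H_data^{a,k+1}(Δ̲_{≤s*})} (as an inequality in [0,∞]). -/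
open MeasureTheory

/-- The operator `f ↦ |y| ∂_{y^i} f`, with the derivative taken within the set `W`
(the domain on which `f` is smooth). -/
noncomputable def homDeriv (W : Set (EuclideanSpace ℝ (Fin 3))) (i : Fin 3)
    (f : EuclideanSpace ℝ (Fin 3) → ℝ) : EuclideanSpace ℝ (Fin 3) → ℝ :=
  fun y => ‖y‖ * fderivWithin ℝ f W y (EuclideanSpace.single i 1)

/-- Iterated derivatives `(|y|∂_{y^{i₁}}) ⋯ (|y|∂_{y^{i_j}}) f`. -/
noncomputable def homDerivIter (W : Set (EuclideanSpace ℝ (Fin 3))) :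
    (j : ℕ) → (Fin j → Fin 3) → (EuclideanSpace ℝ (Fin 3) → ℝ) →
      EuclideanSpace ℝ (Fin 3) → ℝ
  | 0, _, f => f
  | j + 1, l, f => homDeriv W (l 0) (homDerivIter W j (fun m => l m.succ) f)

/-- The homogeneous norm `‖f‖_{H_b^k(U)}` (valued in `[0,∞]`), with
`‖f‖²_{H_b^k(U)} = Σ_{j=0}^{k} Σ_{i₁,…,i_j} ∫_U |(|y|∂_{i₁})⋯(|y|∂_{i_j}) f|² |y|⁻³ dy`;
derivatives are taken within `W`. -/
noncomputable def HbNorm (W U : Set (EuclideanSpace ℝ (Fin 3))) (k : ℕ)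
    (f : EuclideanSpace ℝ (Fin 3) → ℝ) : ENNReal :=
  (∑ j ∈ Finset.range (k + 1), ∑ l : Fin j → Fin 3,
    ∫⁻ y in U, ENNReal.ofReal ((homDerivIter W j l f y) ^ 2 / ‖y‖ ^ 3)) ^ (1/2 : ℝ)

/-- The homogeneous norm `‖f‖_{C_b^k(U)}` (valued in `[0,∞]`),
`Σ_{j=0}^{k} Σ_{i₁,…,i_j} sup_U |(|y|∂_{i₁})⋯(|y|∂_{i_j}) f|`. -/
noncomputable def CbNorm (W U : Set (EuclideanSpace ℝ (Fin 3))) (k : ℕ)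
    (f : EuclideanSpace ℝ (Fin 3) → ℝ) : ENNReal :=
  ∑ j ∈ Finset.range (k + 1), ∑ l : Fin j → Fin 3,
    ⨆ y ∈ U, ENNReal.ofReal |homDerivIter W j l f y|

/-- The closed annulus `A(s₀,s₁) = {y ∈ ℝ³ : s₀ ≤ |y| ≤ s₁}`. -/
def annulus (s₀ s₁ : ℝ) : Set (EuclideanSpace ℝ (Fin 3)) := {y | s₀ ≤ ‖y‖ ∧ ‖y‖ ≤ s₁}

/-- The punctured ball `Δ̲_{≤s} = {y ∈ ℝ³ : 0 < |y| ≤ s}`. -/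
def deltaData (s : ℝ) : Set (EuclideanSpace ℝ (Fin 3)) := {y | 0 < ‖y‖ ∧ ‖y‖ ≤ s}

/-- The weighted data norm
`‖f‖_{H_data^{a,k}(Δ̲_{≤s*})} = ∫₀^{s*} (s*/s)^{a+k-1} (1+|log(s*/s)|)^{k-1}
  ‖f‖_{H_b^k(A(s/3,s))} ds/s` (valued in `[0,∞]`). -/
noncomputable def HdataNorm (sstar a : ℝ) (k : ℕ)
    (f : EuclideanSpace ℝ (Fin 3) → ℝ) : ENNReal :=
  ∫⁻ s in Set.Ioc (0 : ℝ) sstar,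
    ENNReal.ofReal ((sstar / s) ^ (a + (k : ℝ) - 1) * (1 + |Real.log (sstar / s)|) ^ (k - 1) / s) *
      HbNorm (deltaData sstar) (annulus (s / 3) s) k f


open Set in
lemma polar_lintegral (F : EuclideanSpace ℝ (Fin 3) → ENNReal) (hF : Measurable F) :
    ∫⁻ y, F y = ∫⁻ w, (∫⁻ r in Ioi (0:ℝ), ENNReal.ofReal (r^2) * F (r • (w : EuclideanSpace ℝ (Fin 3))))
      ∂(volume : Measure (EuclideanSpace ℝ (Fin 3))).toSphere := by
  have h0 : ∫⁻ y, F y = ∫⁻ y in ({0}ᶜ : Set (EuclideanSpace ℝ (Fin 3))), F y := by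
    rw [restrict_compl_singleton]
  have hmp := (volume : Measure (EuclideanSpace ℝ (Fin 3))).measurePreserving_homeomorphUnitSphereProd
  have hdim : Module.finrank ℝ (EuclideanSpace ℝ (Fin 3)) - 1 = 2 := by simp
  rw [hdim] at hmp
  let G : Metric.sphere (0 : EuclideanSpace ℝ (Fin 3)) 1 × Ioi (0:ℝ) → ENNReal :=
    fun p => F ((p.2 : ℝ) • (p.1 : EuclideanSpace ℝ (Fin 3)))
  have hG : Measurable G := by
    apply hF.comp
    exact Measurable.smul (measurable_subtype_coe.comp measurable_snd)
      (measurable_subtype_coe.comp measurable_fst)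
  rw [h0, ← lintegral_subtype_comap (by measurability)]
  have h1 : ∀ y : ({0}ᶜ : Set (EuclideanSpace ℝ (Fin 3))),
      F y = G (homeomorphUnitSphereProd _ y) := by
    intro y
    have hy : ‖(y : EuclideanSpace ℝ (Fin 3))‖ ≠ 0 :=
      norm_ne_zero_iff.2 (fun h => y.2 h)
    simp [G, smul_smul, hy]
  simp_rw [h1]
  rw [hmp.lintegral_comp hG, lintegral_prod _ hG.aemeasurable]
  congr 1
  ext w
  rw [Measure.volumeIoiPow, lintegral_withDensity_eq_lintegral_mul _ (by fun_prop)
    (g := fun r => G (w, r)) (hG.comp measurable_prodMk_left)]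
  rw [← lintegral_subtype_comap measurableSet_Ioi]
  rfl

open Set in
lemma annulus_measurable (a b : ℝ) : MeasurableSet (annulus a b) :=
  (measurableSet_le measurable_const measurable_norm).inter
    (measurableSet_le measurable_norm measurable_const)

open Set in
lemma polar_annulus (F : EuclideanSpace ℝ (Fin 3) → ENNReal) (a b : ℝ) (ha : 0 < a)
    (hF : Measurable ((annulus a b).indicator F)) :
    ∫⁻ y in annulus a b, F y =
      ∫⁻ w, (∫⁻ r in Icc a b, ENNReal.ofReal (r^2) * F (r • (w : EuclideanSpace ℝ (Fin 3))))
      ∂(volume : Measure (EuclideanSpace ℝ (Fin 3))).toSphere := by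
  rw [← lintegral_indicator (annulus_measurable a b), polar_lintegral _ hF]
  congr 1
  ext w
  have hw : ‖(w : EuclideanSpace ℝ (Fin 3))‖ = 1 := by simp
  rw [← lintegral_indicator measurableSet_Ioi, ← lintegral_indicator measurableSet_Icc]
  congr 1
  ext r
  by_cases hr : r ∈ Icc a b
  · have hr0 : 0 < r := lt_of_lt_of_le ha hr.1
    have : r • (w : EuclideanSpace ℝ (Fin 3)) ∈ annulus a b := by
      simp [annulus, norm_smul, hw, abs_of_pos hr0, hr.1, hr.2]
    simp [hr, hr0, this]
  · rw [indicator_of_notMem hr]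
    by_cases hr0 : r ∈ Ioi (0:ℝ)
    · have : r • (w : EuclideanSpace ℝ (Fin 3)) ∉ annulus a b := by
        simp only [annulus, mem_ofPred_eq, norm_smul, hw, Real.norm_eq_abs, abs_of_pos hr0.out, mul_one]
        exact hr
      simp [this]
    · rw [indicator_of_notMem hr0]

open Set in
lemma ray_ineq (s : ℝ) (hs : 0 < s) (h h' R : ℝ → ℝ) (hc : ContinuousOn h (Icc (s/3) s))
    (hc' : ContinuousOn h' (Icc (s/3) s)) (hd : ∀ r ∈ Ioo (s/3) s, HasDerivAt h (h' r) r)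
    (hR : ∀ r ∈ Icc (s/3) s,
      (18 * (if r ≤ 5*s/6 then (h r)^2 else 0) + 108 / s^2 * ((s - r)^2 * (r * h' r)^2)) / r ≤ R r) :
    ∫⁻ r in Icc (s/3) s, ENNReal.ofReal ((h r)^2 / r) ≤
      ∫⁻ r in Icc (s/3) s, ENNReal.ofReal (R r) := by
  have hle : s/3 ≤ s := by linarith
  let E : ℝ → ℝ := fun r => 2 * h r * h' r * ((s - r) * (r - s/3)) + (h r)^2 * (4*s/3 - 2*r)
  have hEc : ContinuousOn E (Icc (s/3) s) := by fun_prop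
  have hE0 : ∫ r in (s/3)..s, E r = 0 := by
    rw [intervalIntegral.integral_eq_sub_of_hasDerivAt_of_le (f := fun r => (h r)^2 * ((s - r) * (r - s/3))) hle]
    · simp
    · fun_prop
    · intro r hr
      have h1 := (hd r hr).pow 2
      have h2 : HasDerivAt (fun r : ℝ => (s - r) * (r - s/3)) (4*s/3 - 2*r) r := by
        have := ((hasDerivAt_id r).const_sub s).mul ((hasDerivAt_id r).sub_const (s/3))
        exact this.congr_deriv (by simp only [id]; ring)
      exact (h1.mul h2).congr_deriv (by simp only [E, Pi.pow_apply]; push_cast; ring)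
    · exact hEc.intervalIntegrable_of_Icc hle
  have hE1 : ∫ r in Icc (s/3) s, E r = 0 := by
    rw [integral_Icc_eq_integral_Ioc, ← intervalIntegral.integral_of_le hle, hE0]
  let P : ℝ → ℝ := fun r => 3 / s * (h r)^2
  have hPc : ContinuousOn P (Icc (s/3) s) := by fun_prop
  have hPi : IntegrableOn P (Icc (s/3) s) := hPc.integrableOn_Icc
  have hEi : IntegrableOn E (Icc (s/3) s) := hEc.integrableOn_Icc
  let G : ℝ → ℝ := fun r => P r + 18 / s^2 * E r
  have hGi : IntegrableOn G (Icc (s/3) s) := hPi.add (hEi.const_mul _)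
  have hG : ∫ r in Icc (s/3) s, G r = ∫ r in Icc (s/3) s, P r := by
    simp only [G]
    rw [integral_add hPi (hEi.const_mul _), integral_const_mul (18 / s^2) E, hE1]; simp
  have hGR : ∀ r ∈ Icc (s/3) s, G r ≤ R r := by
    intro r hr
    refine le_trans ?_ (hR r hr)
    have hr0 : 0 < r := by linarith [hr.1]
    have hrs := hr.2
    have hr3 := hr.1
    set ψ := (s - r) * (r - s/3) with hψ
    have hψ0 : 0 ≤ ψ := mul_nonneg (by linarith) (by linarith)
    have hψ2 : ψ ≤ (s - r) * r := mul_le_mul_of_nonneg_left (by linarith) (by linarith)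
    have hψ3 : ψ^2 ≤ ((s - r) * r)^2 := pow_le_pow_left₀ hψ0 hψ2 2
    have hy : 2 * h r * h' r * ψ ≤ s/6 * (h r)^2 + 6/s * ((h' r)^2 * ψ^2) := by
      have : s/6 * (h r)^2 + 6/s * ((h' r)^2 * ψ^2) - 2 * h r * h' r * ψ
          = 6 / s * (s/6 * h r - h' r * ψ)^2 := by field_simp; ring
      have : 0 ≤ 6 / s * (s/6 * h r - h' r * ψ)^2 := by positivity
      linarith
    have hy2 : 6/s * ((h' r)^2 * ψ^2) ≤ 6/s * ((s-r)^2 * (r * h' r)^2) := by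
      have : (h' r)^2 * ψ^2 ≤ (h' r)^2 * ((s - r) * r)^2 :=
        mul_le_mul_of_nonneg_left hψ3 (sq_nonneg _)
      have h6 : 0 ≤ 6 / s := by positivity
      calc _ ≤ 6/s * ((h' r)^2 * ((s - r) * r)^2) := mul_le_mul_of_nonneg_left this h6
        _ = _ := by ring
    set K := (s-r)^2 * (r * h' r)^2 with hK
    have hK0 : 0 ≤ K := by positivity
    set c := (if r ≤ 5*s/6 then (h r)^2 else 0) with hcdef
    have hc0 : 0 ≤ c := by rw [hcdef]; split_ifs <;> positivity
    have hEb : E r ≤ - (s/6) * (h r)^2 + s * c + 6/s * K := by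
      have h2 : (h r)^2 * (4*s/3 - 2*r) ≤ - (s/3) * (h r)^2 + s * c := by
        have hh := sq_nonneg (h r)
        rw [hcdef]; split_ifs with hcase
        · nlinarith
        · push Not at hcase
          nlinarith
      have hEr : E r = 2 * h r * h' r * ψ + (h r)^2 * (4*s/3 - 2*r) := rfl
      linarith
    have hstep : G r ≤ (18 * c + 108 / s^2 * K) / s := by
      have h18 : 0 ≤ 18 / s^2 := by positivity
      have := mul_le_mul_of_nonneg_left hEb h18
      have e : 18 / s^2 * (- (s/6) * (h r)^2 + s * c + 6/s * K)
        = - (3 / s * (h r)^2) + (18 * c + 108 / s^2 * K) / s := by field_simp; ring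
      simp only [G, P]; linarith
    refine hstep.trans ?_
    apply div_le_div_of_nonneg_left _ hr0 hrs
    positivity
  calc ∫⁻ r in Icc (s/3) s, ENNReal.ofReal ((h r)^2 / r)
      ≤ ∫⁻ r in Icc (s/3) s, ENNReal.ofReal (P r) := by
        apply setLIntegral_mono' measurableSet_Icc
        intro r hr
        apply ENNReal.ofReal_le_ofReal
        have hr0 : 0 < r := by linarith [hr.1]
        have hr3 := hr.1
        simp only [P]
        rw [div_mul_eq_mul_div, div_le_div_iff₀ hr0 hs]
        nlinarith [sq_nonneg (h r)]
    _ = ENNReal.ofReal (∫ r in Icc (s/3) s, P r) := by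
        rw [ofReal_integral_eq_lintegral_ofReal hPi]
        exact Filter.Eventually.of_forall (fun r => by simp only [P]; positivity)
    _ = ENNReal.ofReal (∫ r in Icc (s/3) s, G r) := by rw [hG]
    _ ≤ ENNReal.ofReal (∫ r in Icc (s/3) s, max (G r) 0) := by
        apply ENNReal.ofReal_le_ofReal
        exact integral_mono hGi hGi.pos_part (fun r => le_max_left _ _)
    _ = ∫⁻ r in Icc (s/3) s, ENNReal.ofReal (max (G r) 0) := by
        rw [ofReal_integral_eq_lintegral_ofReal hGi.pos_part]
        exact Filter.Eventually.of_forall (fun r => le_max_right _ _)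
    _ ≤ _ := by
        apply setLIntegral_mono' measurableSet_Icc
        intro r hr
        rw [ENNReal.ofReal_max]
        simp only [ENNReal.ofReal_zero, zero_le, sup_of_le_left]
        exact ENNReal.ofReal_le_ofReal (hGR r hr)

lemma deltaData_uniqueDiffOn (R : ℝ) (hR : 0 < R) : UniqueDiffOn ℝ (deltaData R) := by
  have h : deltaData R = Metric.closedBall (0 : EuclideanSpace ℝ (Fin 3)) R ∩ {0}ᶜ := by
    ext y
    simp [deltaData, and_comm]
  rw [h]
  apply UniqueDiffOn.inter _ isOpen_compl_singleton
  apply uniqueDiffOn_convex (convex_closedBall _ _)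
  rw [interior_closedBall _ hR.ne']
  exact ⟨0, by simpa using hR⟩

lemma homDeriv_contDiffOn (R : ℝ) (hR : 0 < R) (g : EuclideanSpace ℝ (Fin 3) → ℝ)
    (hg : ContDiffOn ℝ (⊤ : ℕ∞) g (deltaData R)) (i : Fin 3) :
    ContDiffOn ℝ (⊤ : ℕ∞) (homDeriv (deltaData R) i g) (deltaData R) := by
  unfold homDeriv
  apply ContDiffOn.mul
  · exact contDiffOn_id.norm ℝ (fun x hx => norm_pos_iff.1 hx.1)
  · exact (hg.fderivWithin (m := (⊤ : ℕ∞)) (deltaData_uniqueDiffOn R hR) (by simp)).clm_apply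
      contDiffOn_const

lemma homDerivIter_contDiffOn (R : ℝ) (hR : 0 < R) (f : EuclideanSpace ℝ (Fin 3) → ℝ)
    (hf : ContDiffOn ℝ (⊤ : ℕ∞) f (deltaData R)) (j : ℕ) (l : Fin j → Fin 3) :
    ContDiffOn ℝ (⊤ : ℕ∞) (homDerivIter (deltaData R) j l f) (deltaData R) := by
  induction j with
  | zero => exact hf
  | succ j ih => exact homDeriv_contDiffOn R hR _ (ih _) _

lemma measurable_indicator_of_continuousOn (A : Set (EuclideanSpace ℝ (Fin 3)))
    (hA : MeasurableSet A) (F : EuclideanSpace ℝ (Fin 3) → ℝ) (hF : ContinuousOn F A) :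
    Measurable (A.indicator F) := by
  classical
  rw [← Set.piecewise_eq_indicator]
  exact hF.measurable_piecewise continuousOn_const hA

lemma annulus_subset_deltaData (s a b R : ℝ) (hs : 0 < s) (ha : s ≤ a) (hR : b ≤ R) :
    annulus a b ⊆ deltaData R := fun _ hy => ⟨by linarith [hy.1], hy.2.trans hR⟩

lemma measurable_density (A : Set (EuclideanSpace ℝ (Fin 3)))
    (hA : MeasurableSet A) (F : EuclideanSpace ℝ (Fin 3) → ℝ) (hF : ContinuousOn F A) :
    Measurable (A.indicator (fun y => ENNReal.ofReal ((F y)^2 / ‖y‖^3))) := by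
  have : A.indicator (fun y => ENNReal.ofReal ((F y)^2 / ‖y‖^3)) =
      fun y => ENNReal.ofReal ((A.indicator F y)^2 / ‖y‖^3) := by
    ext y
    by_cases hy : y ∈ A <;> simp [hy]
  rw [this]
  have := measurable_indicator_of_continuousOn A hA F hF
  fun_prop

lemma radial_sq_le (L : EuclideanSpace ℝ (Fin 3) →L[ℝ] ℝ) (w : EuclideanSpace ℝ (Fin 3))
    (hw : ‖w‖ = 1) (r : ℝ) :
    (r * L w)^2 ≤ ∑ i, (r * L (EuclideanSpace.single i 1))^2 := by
  have h1 : L w = ∑ i, w i * L (EuclideanSpace.single i 1) := by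
    have h2 : w = ∑ i, w i • EuclideanSpace.single i (1:ℝ) := by
      ext j
      fin_cases j <;> simp [Fin.sum_univ_three]
    conv_lhs => rw [h2]
    simp
  have h3 : ∑ i, (w i)^2 = 1 := by
    have := EuclideanSpace.real_norm_sq_eq w
    rw [hw] at this
    linarith
  have h4 := Finset.sum_mul_sq_le_sq_mul_sq Finset.univ (fun i => w i)
    (fun i => L (EuclideanSpace.single i 1))
  rw [h3, one_mul, ← h1] at h4
  simp_rw [mul_pow, ← Finset.mul_sum]
  exact mul_le_mul_of_nonneg_left h4 (sq_nonneg r)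

open Set in
lemma g_ineq_real (s R : ℝ) (hs : 0 < s) (hsR : s ≤ R) (g : EuclideanSpace ℝ (Fin 3) → ℝ)
    (hg : ContDiffOn ℝ (⊤ : ℕ∞) g (deltaData R)) :
    ∫⁻ y in annulus (s/3) s, ENNReal.ofReal ((g y)^2 / ‖y‖^3) ≤
    ∫⁻ y in annulus (s/3) s, ENNReal.ofReal
      ((18 * (if ‖y‖ ≤ 5*s/6 then (g y)^2 else 0) +
        108 / s^2 * ((s - ‖y‖)^2 * ∑ i, (homDeriv (deltaData R) i g y)^2)) / ‖y‖^3) := by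
  have hR : 0 < R := lt_of_lt_of_le hs hsR
  have hA := annulus_measurable (s/3) s
  have hsub : annulus (s/3) s ⊆ deltaData R :=
    annulus_subset_deltaData (s/3) (s/3) s R (by linarith) le_rfl hsR
  have hgc : ContinuousOn g (annulus (s/3) s) := hg.continuousOn.mono hsub
  have hdc : ∀ i, ContinuousOn (homDeriv (deltaData R) i g) (annulus (s/3) s) := fun i =>
    (homDeriv_contDiffOn R hR g hg i).continuousOn.mono hsub
  have hm2 : Measurable ((annulus (s/3) s).indicator (fun y => ENNReal.ofReal
      ((18 * (if ‖y‖ ≤ 5*s/6 then (g y)^2 else 0) +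
        108 / s^2 * ((s - ‖y‖)^2 * ∑ i, (homDeriv (deltaData R) i g y)^2)) / ‖y‖^3))) := by
    have : (annulus (s/3) s).indicator (fun y => ENNReal.ofReal
      ((18 * (if ‖y‖ ≤ 5*s/6 then (g y)^2 else 0) +
        108 / s^2 * ((s - ‖y‖)^2 * ∑ i, (homDeriv (deltaData R) i g y)^2)) / ‖y‖^3)) =
        fun y => ENNReal.ofReal
      ((18 * (if ‖y‖ ≤ 5*s/6 then ((annulus (s/3) s).indicator g y)^2 else 0) +
        108 / s^2 * ((s - ‖y‖)^2 *
          ∑ i, ((annulus (s/3) s).indicator (homDeriv (deltaData R) i g) y)^2)) / ‖y‖^3) := by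
      ext y
      by_cases hy : y ∈ annulus (s/3) s <;> simp [hy]
    rw [this]
    have h1 := measurable_indicator_of_continuousOn _ hA g hgc
    have h2 := fun i => measurable_indicator_of_continuousOn _ hA _ (hdc i)
    have h3 : Measurable (fun y : EuclideanSpace ℝ (Fin 3) =>
        if ‖y‖ ≤ 5*s/6 then ((annulus (s/3) s).indicator g y)^2 else 0) :=
      Measurable.ite (measurableSet_le measurable_norm measurable_const) (h1.pow_const 2)
        measurable_const
    fun_prop
  rw [polar_annulus _ _ _ (by linarith) (measurable_density _ hA g hgc),
    polar_annulus _ _ _ (by linarith) hm2]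
  apply lintegral_mono
  intro w
  have hw : ‖(w : EuclideanSpace ℝ (Fin 3))‖ = 1 := by simp
  set v : EuclideanSpace ℝ (Fin 3) := (w : EuclideanSpace ℝ (Fin 3)) with hv
  have hnorm : ∀ r ∈ Icc (s/3) s, ‖r • v‖ = r := by
    intro r hr
    rw [norm_smul, hw, mul_one, Real.norm_eq_abs, abs_of_pos (by linarith [hr.1])]
  have hmem : ∀ r ∈ Icc (s/3) s, r • v ∈ annulus (s/3) s := by
    intro r hr
    refine ⟨?_, ?_⟩ <;> rw [hnorm r hr]
    exacts [hr.1, hr.2]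
  have key := ray_ineq s hs (fun r => g (r • v)) (fun r => fderivWithin ℝ g (deltaData R) (r • v) v)
    (fun r => r^2 * ((18 * (if ‖r • v‖ ≤ 5*s/6 then (g (r • v))^2 else 0) +
        108 / s^2 * ((s - ‖r • v‖)^2 * ∑ i, (homDeriv (deltaData R) i g (r • v))^2)) / ‖r • v‖^3))
    ?_ ?_ ?_ ?_
  · refine le_trans (le_of_eq ?_) (key.trans (le_of_eq ?_))
    · apply setLIntegral_congr_fun measurableSet_Icc
      intro r hr
      have hr0 : 0 < r := by linarith [hr.1]
      simp only []
      rw [← ENNReal.ofReal_mul (by positivity), hnorm r hr]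
      congr 1
      rw [← hv]
      field_simp
    · apply setLIntegral_congr_fun measurableSet_Icc
      intro r hr
      simp only []
      rw [← ENNReal.ofReal_mul (by positivity)]
  · exact hgc.comp (by fun_prop) hmem
  · have : ContinuousOn (fderivWithin ℝ g (deltaData R)) (annulus (s/3) s) :=
      (hg.continuousOn_fderivWithin (deltaData_uniqueDiffOn R hR) (by simp)).mono hsub
    exact (this.comp (by fun_prop) hmem).clm_apply continuousOn_const
  · intro r hr
    have hr' : r ∈ Icc (s/3) s := ⟨hr.1.le, hr.2.le⟩
    have hnhds : deltaData R ∈ nhds (r • v) := by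
      have ho : IsOpen {y : EuclideanSpace ℝ (Fin 3) | 0 < ‖y‖ ∧ ‖y‖ < R} :=
        (isOpen_lt continuous_const continuous_norm).inter
          (isOpen_lt continuous_norm continuous_const)
      refine Filter.mem_of_superset (ho.mem_nhds ?_) (fun y hy => ⟨hy.1, hy.2.le⟩)
      constructor <;> rw [hnorm r hr']
      · linarith [hr.1]
      · linarith [hr.2]
    have hdiff : HasFDerivAt g (fderivWithin ℝ g (deltaData R) (r • v)) (r • v) :=
      ((hg.differentiableOn (by simp) _ (hsub (hmem r hr'))).hasFDerivWithinAt).hasFDerivAt hnhds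
    have hsm : HasDerivAt (fun r : ℝ => r • v) v r := by
      simpa using (hasDerivAt_id r).smul_const v
    exact hdiff.comp_hasDerivAt r hsm
  · intro r hr
    have hr0 : 0 < r := by linarith [hr.1]
    have hrad := radial_sq_le (fderivWithin ℝ g (deltaData R) (r • v)) v hw r
    simp only [homDeriv]
    rw [hnorm r hr]
    set S := ∑ i, (r * (fderivWithin ℝ g (deltaData R) (r • v)) (EuclideanSpace.single i 1))^2
    set c := (if r ≤ 5*s/6 then (g (r • v))^2 else 0)
    have e : r^2 * ((18 * c + 108 / s^2 * ((s - r)^2 * S)) / r^3)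
      = (18 * c + 108 / s^2 * ((s - r)^2 * S)) / r := by field_simp
    rw [e]
    gcongr

open Set in
lemma g_ineq (s R : ℝ) (hs : 0 < s) (hsR : s ≤ R) (g : EuclideanSpace ℝ (Fin 3) → ℝ)
    (hg : ContDiffOn ℝ (⊤ : ℕ∞) g (deltaData R)) :
    ∫⁻ y in annulus (s/3) s, ENNReal.ofReal ((g y)^2 / ‖y‖^3) ≤
      18 * (∫⁻ y in annulus (s/3) (5*s/6), ENNReal.ofReal ((g y)^2 / ‖y‖^3)) +
      ENNReal.ofReal (108 / s^2) * ∑ i, ∫⁻ y in annulus (s/3) s,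
        ENNReal.ofReal ((s - ‖y‖)^2) *
          ENNReal.ofReal ((homDeriv (deltaData R) i g y)^2 / ‖y‖^3) := by
  have hR : 0 < R := lt_of_lt_of_le hs hsR
  have hA := annulus_measurable (s/3) s
  have hB := annulus_measurable (s/3) (5*s/6)
  have hBA : annulus (s/3) (5*s/6) ⊆ annulus (s/3) s := fun y hy => ⟨hy.1, by linarith [hy.2]⟩
  have hsub : annulus (s/3) s ⊆ deltaData R :=
    annulus_subset_deltaData (s/3) (s/3) s R (by linarith) le_rfl hsR
  have hgc : ContinuousOn g (annulus (s/3) s) := hg.continuousOn.mono hsub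
  have hdc : ∀ i, ContinuousOn (homDeriv (deltaData R) i g) (annulus (s/3) s) := fun i =>
    (homDeriv_contDiffOn R hR g hg i).continuousOn.mono hsub
  have hmB := measurable_density _ hB g (hgc.mono hBA)
  have hmD : ∀ i, AEMeasurable (fun y => ENNReal.ofReal ((homDeriv (deltaData R) i g y)^2 / ‖y‖^3))
      (volume.restrict (annulus (s/3) s)) := fun i =>
    (aemeasurable_indicator_iff hA).1 (measurable_density _ hA _ (hdc i)).aemeasurable
  have hmE : ∀ i, AEMeasurable (fun y => ENNReal.ofReal ((s - ‖y‖)^2) *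
        ENNReal.ofReal ((homDeriv (deltaData R) i g y)^2 / ‖y‖^3))
      (volume.restrict (annulus (s/3) s)) := fun i =>
    AEMeasurable.mul (by fun_prop) (hmD i)
  refine (g_ineq_real s R hs hsR g hg).trans ?_
  calc _ ≤ ∫⁻ y in annulus (s/3) s,
      (18 * (annulus (s/3) (5*s/6)).indicator (fun y => ENNReal.ofReal ((g y)^2 / ‖y‖^3)) y +
        ENNReal.ofReal (108 / s^2) * ∑ i, (ENNReal.ofReal ((s - ‖y‖)^2) *
          ENNReal.ofReal ((homDeriv (deltaData R) i g y)^2 / ‖y‖^3))) := by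
        apply setLIntegral_mono' hA
        intro y hy
        have hy0 : 0 < ‖y‖ := by linarith [hy.1]
        rw [add_div, mul_div_assoc 18, mul_div_assoc (108 / s^2), mul_div_assoc ((s - ‖y‖)^2),
          Finset.sum_div]
        refine ENNReal.ofReal_add_le.trans ?_
        rw [ENNReal.ofReal_mul (by norm_num), ENNReal.ofReal_mul (by positivity),
          ENNReal.ofReal_mul (by positivity), ENNReal.ofReal_sum_of_nonneg (fun i _ => by positivity),
          Finset.mul_sum]
        gcongr
        · simp
        · by_cases hc : ‖y‖ ≤ 5*s/6
          · have : y ∈ annulus (s/3) (5*s/6) := ⟨hy.1, hc⟩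
            simp [hc, this]
          · simp [hc]
    _ = _ := by
        rw [lintegral_add_left (hmB.const_mul _), lintegral_const_mul _ hmB,
          lintegral_const_mul' _ _ ENNReal.ofReal_ne_top,
          lintegral_finsetSum' _ (fun i _ => hmE i), setLIntegral_indicator hB,
          inter_eq_left.2 hBA]

open Set in
lemma layer_bounds {α : Type*} [MeasurableSpace α] (μ : Measure α) (φ : α → ℝ)
    (hφ : Measurable φ) (hφ0 : 0 ≤ᵐ[μ] φ) (N : ℝ → ENNReal)
    (hN : ∀ τ, 0 < τ → μ {y | τ ≤ φ y} ^ (1/2 : ℝ) ≤ N τ) :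
    (∀ τ, 0 < τ → ENNReal.ofReal (τ^2) * μ {y | τ ≤ φ y} ≤ (∫⁻ τ in Ioi (0:ℝ), N τ)^2) ∧
    ∫⁻ y, ENNReal.ofReal ((φ y)^2) ∂μ ≤ 2 * (∫⁻ τ in Ioi (0:ℝ), N τ)^2 := by
  set M := ∫⁻ τ in Ioi (0:ℝ), N τ with hM
  have hsq : ∀ x : ENNReal, (x ^ (1/2 : ℝ))^2 = x := by
    intro x
    rw [← ENNReal.rpow_natCast, ← ENNReal.rpow_mul]
    norm_num
  have hmono : ∀ τ, 0 < τ → ENNReal.ofReal τ * μ {y | τ ≤ φ y} ^ (1/2 : ℝ) ≤ M := by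
    intro τ hτ
    calc ENNReal.ofReal τ * μ {y | τ ≤ φ y} ^ (1/2 : ℝ)
        = ∫⁻ _ in Ioc (0:ℝ) τ, μ {y | τ ≤ φ y} ^ (1/2 : ℝ) := by
          rw [setLIntegral_const, Real.volume_Ioc, sub_zero, mul_comm]
      _ ≤ ∫⁻ t in Ioc (0:ℝ) τ, N t := by
          apply setLIntegral_mono' measurableSet_Ioc
          intro t ht
          refine le_trans ?_ (hN t ht.1)
          gcongr
          exact ht.2
      _ ≤ M := lintegral_mono_set Ioc_subset_Ioi_self
  refine ⟨?_, ?_⟩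
  · intro τ hτ
    have := pow_le_pow_left₀ (zero_le) (hmono τ hτ) 2
    rwa [mul_pow, hsq, ← ENNReal.ofReal_pow hτ.le] at this
  · by_cases hMt : M = ⊤
    · rw [hMt]; simp
    have h1 := lintegral_rpow_eq_lintegral_meas_le_mul μ hφ0 hφ.aemeasurable (p := 2) (by norm_num)
    have h2 : ∫⁻ y, ENNReal.ofReal ((φ y)^2) ∂μ = ∫⁻ y, ENNReal.ofReal ((φ y)^(2:ℝ)) ∂μ := by
      simp
    rw [h2, h1]
    have h3 : ENNReal.ofReal 2 = 2 := by simp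
    rw [h3]
    gcongr
    calc _ ≤ ∫⁻ t in Ioi (0:ℝ), M * N t := by
          apply setLIntegral_mono' measurableSet_Ioi
          intro t ht
          have e : t ^ ((2:ℝ) - 1) = t := by norm_num
          rw [e]
          calc μ {y | t ≤ φ y} * ENNReal.ofReal t
              = (ENNReal.ofReal t * μ {y | t ≤ φ y} ^ (1/2 : ℝ)) * μ {y | t ≤ φ y} ^ (1/2 : ℝ) := by
                conv_lhs => rw [← hsq (μ {y | t ≤ φ y})]
                ring
            _ ≤ M * N t := mul_le_mul' (hmono t ht) (hN t ht)
      _ = M^2 := by rw [lintegral_const_mul' _ _ hMt, sq]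

open Set in
lemma main_bound (k : ℕ) (s R : ℝ) (hs : 0 < s) (hsR : s ≤ R) (f : EuclideanSpace ℝ (Fin 3) → ℝ)
    (hf : ContDiffOn ℝ (⊤ : ℕ∞) f (deltaData R)) :
    HbNorm (deltaData R) (annulus (s/3) s) k f ≤ ENNReal.ofReal (30 / s) *
      ∫⁻ t in Ico (s/3) s, HbNorm (deltaData R) (annulus (t/3) t) (k+1) f := by
  have hR : 0 < R := lt_of_lt_of_le hs hsR
  set A := annulus (s/3) s with hAdef
  have hA : MeasurableSet A := annulus_measurable (s/3) s
  have hsub : A ⊆ deltaData R :=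
    annulus_subset_deltaData (s/3) (s/3) s R (by linarith) le_rfl hsR
  let q : (j : ℕ) → (Fin j → Fin 3) → EuclideanSpace ℝ (Fin 3) → ENNReal := fun j l y =>
    ENNReal.ofReal ((homDerivIter (deltaData R) j l f y) ^ 2 / ‖y‖ ^ 3)
  have hqm : ∀ j l, AEMeasurable (q j l) (volume.restrict A) := fun j l =>
    (aemeasurable_indicator_iff hA).1 (measurable_density _ hA _
      ((homDerivIter_contDiffOn R hR f hf j l).continuousOn.mono hsub)).aemeasurable
  let Q : EuclideanSpace ℝ (Fin 3) → ENNReal := fun y =>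
    ∑ j ∈ Finset.range (k + 1 + 1), ∑ l : Fin j → Fin 3, q j l y
  have hQm : AEMeasurable Q (volume.restrict A) :=
    Finset.aemeasurable_fun_sum _ (fun j _ => Finset.aemeasurable_fun_sum _ (fun l _ => hqm j l))
  let μ : Measure (EuclideanSpace ℝ (Fin 3)) := (volume.restrict A).withDensity Q
  have hμ : ∀ S : Set (EuclideanSpace ℝ (Fin 3)), MeasurableSet S → μ S =
      ∑ j ∈ Finset.range (k + 1 + 1), ∑ l : Fin j → Fin 3, ∫⁻ y in S ∩ A, q j l y := by
    intro S hS
    have hle : volume.restrict (S ∩ A) ≤ volume.restrict A :=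
      Measure.restrict_mono inter_subset_right le_rfl
    simp only [μ]
    rw [withDensity_apply _ hS, Measure.restrict_restrict hS]
    simp only [Q]
    rw [lintegral_finsetSum' _ (fun j _ => Finset.aemeasurable_fun_sum _
      (fun l _ => (hqm j l).mono_measure hle))]
    refine Finset.sum_congr rfl (fun j _ => ?_)
    rw [lintegral_finsetSum' _ (fun l _ => (hqm j l).mono_measure hle)]
  let φ : EuclideanSpace ℝ (Fin 3) → ℝ := fun y => s - ‖y‖
  have hφ : Measurable φ := by fun_prop
  have hφ0 : 0 ≤ᵐ[μ] φ := by
    apply (withDensity_absolutelyContinuous _ _).ae_le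
    filter_upwards [ae_restrict_mem hA] with y hy
    have := hy.2
    simp only [φ, Pi.zero_apply]; linarith
  have hmS : ∀ τ, MeasurableSet {y | τ ≤ φ y} := fun τ => measurableSet_le measurable_const hφ
  let H : ℝ → ENNReal := fun t => HbNorm (deltaData R) (annulus (t/3) t) (k+1) f
  let N : ℝ → ENNReal := fun τ => (Ico (s/3) s).indicator H (s - τ)
  have hN : ∀ τ, 0 < τ → μ {y | τ ≤ φ y} ^ (1/2 : ℝ) ≤ N τ := by
    intro τ hτ
    by_cases h : s/3 ≤ s - τ
    · have hm : s - τ ∈ Ico (s/3) s := ⟨h, by linarith⟩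
      simp only [N]
      rw [indicator_of_mem hm]
      simp only [H, HbNorm]
      gcongr
      rw [hμ _ (hmS τ)]
      gcongr with j _ l _
      rintro y ⟨h1, h2⟩
      have h1' : τ ≤ s - ‖y‖ := h1
      exact ⟨by linarith [h2.1], by linarith⟩
    · have : {y | τ ≤ φ y} ∩ A = ∅ := by
        ext y
        simp only [mem_inter_iff, mem_empty_iff_false, iff_false, not_and]
        intro h1 h2
        have h1' : τ ≤ s - ‖y‖ := h1
        exact h (by linarith [h2.1])
      rw [hμ _ (hmS τ), this]
      simp
  obtain ⟨hb1, hb2⟩ := layer_bounds μ φ hφ hφ0 N hN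
  set M0 := ∫⁻ τ in Ioi (0:ℝ), N τ with hM0
  set M := ∫⁻ t in Ico (s/3) s, HbNorm (deltaData R) (annulus (t/3) t) (k+1) f with hM
  have hMM : M0 ≤ M := by
    calc M0 ≤ ∫⁻ τ, N τ := setLIntegral_le_lintegral _ _
      _ = ∫⁻ τ, (Ico (s/3) s).indicator H τ :=
        lintegral_sub_left_eq_self ((Ico (s/3) s).indicator H) s
      _ = M := lintegral_indicator measurableSet_Ico _
  have hB : ENNReal.ofReal ((s/6)^2) *
      (∑ j ∈ Finset.range (k + 1 + 1), ∑ l : Fin j → Fin 3,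
        ∫⁻ y in annulus (s/3) (5*s/6), q j l y) ≤ M^2 := by
    refine le_trans ?_ ((hb1 (s/6) (by linarith)).trans (pow_le_pow_left₀ zero_le hMM 2))
    rw [hμ _ (hmS _)]
    have : {y | s/6 ≤ φ y} ∩ A = annulus (s/3) (5*s/6) := by
      ext y
      constructor
      · rintro ⟨h1, h2⟩
        have h1' : s/6 ≤ s - ‖y‖ := h1
        exact ⟨h2.1, by linarith⟩
      · intro h
        have h2 := h.2
        refine ⟨?_, h.1, by linarith⟩
        change s/6 ≤ s - ‖y‖
        linarith
    rw [this]
  have hV : ∑ j ∈ Finset.range (k + 1 + 1), ∑ l : Fin j → Fin 3,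
      ∫⁻ y in A, ENNReal.ofReal ((s - ‖y‖)^2) * q j l y ≤ 2 * M^2 := by
    refine le_trans (le_of_eq ?_) (hb2.trans (mul_le_mul_right (pow_le_pow_left₀ zero_le hMM 2) 2))
    simp only [μ]
    rw [lintegral_withDensity_eq_lintegral_mul₀ hQm (by fun_prop)]
    simp only [Pi.mul_apply, Q, φ, Finset.sum_mul]
    have hm : ∀ j l, AEMeasurable (fun y => q j l y * ENNReal.ofReal ((s - ‖y‖)^2))
      (volume.restrict A) := fun j l => (hqm j l).mul (by fun_prop)
    rw [lintegral_finsetSum' _ (fun j _ => Finset.aemeasurable_fun_sum _ (fun l _ => hm j l))]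
    refine Finset.sum_congr rfl (fun j _ => ?_)
    rw [lintegral_finsetSum' _ (fun l _ => hm j l)]
    refine Finset.sum_congr rfl (fun l _ => ?_)
    simp_rw [mul_comm]
  set TB := ∑ j ∈ Finset.range (k + 1 + 1), ∑ l : Fin j → Fin 3,
        ∫⁻ y in annulus (s/3) (5*s/6), q j l y with hTB
  have hsum : ∑ j ∈ Finset.range (k + 1), ∑ l : Fin j → Fin 3, ∫⁻ y in A, q j l y ≤
      18 * TB + ENNReal.ofReal (108 / s^2) * (2 * M^2) := by
    calc _ ≤ ∑ j ∈ Finset.range (k + 1), ∑ l : Fin j → Fin 3,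
          (18 * (∫⁻ y in annulus (s/3) (5*s/6), q j l y) + ENNReal.ofReal (108 / s^2) *
            ∑ i, ∫⁻ y in A, ENNReal.ofReal ((s - ‖y‖)^2) * q (j+1) (Fin.cons i l) y) := by
          refine Finset.sum_le_sum (fun j _ => Finset.sum_le_sum (fun l _ => ?_))
          exact g_ineq s R hs hsR _ (homDerivIter_contDiffOn R hR f hf j l)
      _ = 18 * (∑ j ∈ Finset.range (k + 1), ∑ l : Fin j → Fin 3,
            ∫⁻ y in annulus (s/3) (5*s/6), q j l y) + ENNReal.ofReal (108 / s^2) *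
          (∑ j ∈ Finset.range (k + 1), ∑ l : Fin j → Fin 3, ∑ i,
            ∫⁻ y in A, ENNReal.ofReal ((s - ‖y‖)^2) * q (j+1) (Fin.cons i l) y) := by
          simp only [Finset.sum_add_distrib, Finset.mul_sum]
      _ ≤ _ := by
          gcongr
          · exact Finset.sum_le_sum_of_subset (Finset.range_mono (by omega))
          · refine le_trans ?_ hV
            rw [Finset.sum_range_succ' _ (k+1)]
            refine le_trans (le_of_eq ?_) le_self_add
            refine Finset.sum_congr rfl (fun j _ => ?_)
            rw [Finset.sum_comm, ← Fintype.sum_prod_type']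
            exact Fintype.sum_equiv (Fin.consEquiv (fun _ => Fin 3)) _ _ (fun p => rfl)
  have hTB2 : TB ≤ ENNReal.ofReal (36 / s^2) * M^2 := by
    calc TB = ENNReal.ofReal (36 / s^2) * (ENNReal.ofReal ((s/6)^2) * TB) := by
          rw [← mul_assoc, ← ENNReal.ofReal_mul (by positivity)]
          have : 36 / s^2 * (s/6)^2 = 1 := by field_simp; norm_num
          rw [this]; simp
      _ ≤ _ := by gcongr
  have hfin : ∑ j ∈ Finset.range (k + 1), ∑ l : Fin j → Fin 3, ∫⁻ y in A, q j l y ≤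
      (ENNReal.ofReal (30 / s) * M)^2 := by
    refine hsum.trans ?_
    calc _ ≤ 18 * (ENNReal.ofReal (36 / s^2) * M^2) + ENNReal.ofReal (108 / s^2) * (2 * M^2) := by
          gcongr
      _ = ENNReal.ofReal (864 / s^2) * M^2 := by
          have e1 : (18 : ENNReal) = ENNReal.ofReal 18 := by simp
          have e2 : (2 : ENNReal) = ENNReal.ofReal 2 := by simp
          have e3 : ENNReal.ofReal (864 / s^2) = ENNReal.ofReal 18 * ENNReal.ofReal (36 / s^2) +
              ENNReal.ofReal (108 / s^2) * ENNReal.ofReal 2 := by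
            rw [← ENNReal.ofReal_mul (by positivity), ← ENNReal.ofReal_mul (by positivity),
              ← ENNReal.ofReal_add (by positivity) (by positivity)]
            congr 1
            ring
          rw [e3, ← e1, ← e2]
          ring
      _ ≤ _ := by
          rw [mul_pow, ← ENNReal.ofReal_pow (by positivity)]
          gcongr
          rw [div_pow]
          gcongr
          norm_num
  have hroot := ENNReal.rpow_le_rpow hfin (z := (1/2 : ℝ)) (by norm_num)
  have e : ((ENNReal.ofReal (30 / s) * M)^2)^(1/2 : ℝ) = ENNReal.ofReal (30 / s) * M := by
    rw [← ENNReal.rpow_natCast, ← ENNReal.rpow_mul]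
    norm_num
  rw [e] at hroot
  exact hroot

/-- inequality `(eq:fHfHdata)` of Lemma 6.2: for every `k` there is
`C(k) > 0` such that for all `a ≥ 0`, `0 < s ≤ s* ≤ 1` and every `f` smooth on
`Δ̲_{≤s*}`, `‖f‖_{H_b^k(A(s/3,s))} ≤ C(k) (s/s*)^{a+k} ‖f‖_{H_data^{a,k+1}(Δ̲_{≤s*})}`
(as an inequality in `[0,∞]`). -/
theorem stmt11 (k : ℕ) :
    ∃ C : ℝ, 0 < C ∧
      ∀ a : ℝ, 0 ≤ a → ∀ s sstar : ℝ, 0 < s → s ≤ sstar → sstar ≤ 1 →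
      ∀ f : EuclideanSpace ℝ (Fin 3) → ℝ, ContDiffOn ℝ (⊤ : ℕ∞) f (deltaData sstar) →
      HbNorm (deltaData sstar) (annulus (s / 3) s) k f ≤
        ENNReal.ofReal (C * (s / sstar) ^ (a + (k : ℝ))) * HdataNorm sstar a (k + 1) f := by
  refine ⟨30, by norm_num, ?_⟩
  intro a ha s sstar hs hss _ f hf
  refine (main_bound k s sstar hs hss f hf).trans ?_
  have hS : 0 < sstar := lt_of_lt_of_le hs hss
  have hdiv : 0 < s / sstar := by positivity
  have hpow : 0 < (s / sstar) ^ (a + (k : ℝ)) := Real.rpow_pos_of_pos hdiv _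
  have hsplit : ENNReal.ofReal (30 * (s / sstar) ^ (a + (k : ℝ))) =
      ENNReal.ofReal (30 / s) * ENNReal.ofReal (s * (s / sstar) ^ (a + (k : ℝ))) := by
    rw [← ENNReal.ofReal_mul (by positivity)]
    congr 1
    field_simp
  rw [hsplit, mul_assoc]
  gcongr
  rw [HdataNorm, ← lintegral_const_mul' _ _ ENNReal.ofReal_ne_top]
  have hsub : Set.Ico (s/3) s ⊆ Set.Ioc 0 sstar := fun t ht =>
    ⟨by linarith [ht.1], by linarith [ht.2]⟩
  refine le_trans ?_ (lintegral_mono_set hsub)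
  apply setLIntegral_mono' measurableSet_Ico
  intro t ht
  have ht0 : 0 < t := (hsub ht).1
  rw [← mul_assoc, ← ENNReal.ofReal_mul (by positivity)]
  refine le_mul_of_one_le_left zero_le ?_
  rw [ENNReal.one_le_ofReal]
  have e1 : a + ((k + 1 : ℕ) : ℝ) - 1 = a + k := by push_cast; ring
  rw [e1, Nat.add_sub_cancel]
  have h1 : 1 ≤ (s / sstar) ^ (a + (k : ℝ)) * (sstar / t) ^ (a + (k : ℝ)) := by
    rw [← Real.mul_rpow (by positivity) (by positivity)]
    apply Real.one_le_rpow _ (by positivity)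
    have : s / sstar * (sstar / t) = s / t := by field_simp
    rw [this, one_le_div ht0]
    exact ht.2.le
  have h2 : 1 ≤ (1 + |Real.log (sstar / t)|) ^ k :=
    one_le_pow₀ (by linarith [abs_nonneg (Real.log (sstar / t))])
  have h3 : 1 ≤ s / t := (one_le_div ht0).2 ht.2.le
  calc (1:ℝ) ≤ ((s / sstar) ^ (a + (k : ℝ)) * (sstar / t) ^ (a + (k : ℝ))) *
        (1 + |Real.log (sstar / t)|) ^ k * (s / t) :=
        one_le_mul_of_one_le_of_one_le (one_le_mul_of_one_le_of_one_le h1 h2) h3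
    _ = _ := by ring
end
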